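/- arXiv:2209.10072 — 3 statements merged into one kernel-verified Lean document; each statement's English description precedes it below -/
import Mathlib

section
/- Let S and A be finite nonempty sets, P a transition kernel on S×A, R : S×A → ℝ, γ ∈ [0,1), λ > 0, and Qπ : S×A → ℝ. Then the regularized Bellman operator B̂ is a contraction in the sup norm with modulus γ/(1+λ) < 1: for all Q¹, Q² : S×A → ℝ, ‖B̂Q¹ − B̂Q²‖∞ ≤ (γ/(1+λ)) ‖Q¹ − Q²‖∞. -/
open Finset

/-- Max over actions of a Q-table at a state. -/
noncomputable def maxQ {S A : Type*} [Fintype A] [Nonempty A] (Q : S × A → ℝ) (s : S) : ℝ :=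
  Finset.univ.sup' Finset.univ_nonempty (fun a => Q (s, a))

/-- The regularized Bellman operator
`(B̂Q)(s,a) = (λ/(1+λ))·Qπ(s,a) + (1/(1+λ))·(R(s,a) + γ·Σ_{s'} P(s'|s,a)·max_{a'} Q(s',a'))`. -/
noncomputable def Bhat {S A : Type*} [Fintype S] [Fintype A] [Nonempty A]
    (P : S → A → S → ℝ) (R : S → A → ℝ) (γ lam : ℝ) (Qpi : S × A → ℝ)
    (Q : S × A → ℝ) : S × A → ℝ :=
  fun sa => (lam / (1 + lam)) * Qpi sa +
    (1 / (1 + lam)) * (R sa.1 sa.2 + γ * ∑ s' : S, P sa.1 sa.2 s' * maxQ Q s')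

theorem maxQ_sub_le {S A : Type*} [Fintype S] [Fintype A] [Nonempty A]
    (Q₁ Q₂ : S × A → ℝ) (s : S) : maxQ Q₁ s - maxQ Q₂ s ≤ ‖Q₁ - Q₂‖ := by
  rw [sub_le_iff_le_add]
  refine Finset.sup'_le _ _ fun a _ => ?_
  have hdiff : Q₁ (s, a) - Q₂ (s, a) ≤ ‖Q₁ - Q₂‖ :=
    (le_abs_self _).trans (norm_le_pi_norm (Q₁ - Q₂) (s, a))
  have hmax : Q₂ (s, a) ≤ maxQ Q₂ s :=
    Finset.le_sup' (fun a => Q₂ (s, a)) (Finset.mem_univ a)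
  linarith

theorem abs_maxQ_sub_le {S A : Type*} [Fintype S] [Fintype A] [Nonempty A]
    (Q₁ Q₂ : S × A → ℝ) (s : S) : |maxQ Q₁ s - maxQ Q₂ s| ≤ ‖Q₁ - Q₂‖ := by
  refine abs_sub_le_iff.2 ⟨maxQ_sub_le Q₁ Q₂ s, ?_⟩
  rw [norm_sub_rev]
  exact maxQ_sub_le Q₂ Q₁ s

theorem abs_sum_mul_le_of_sum_eq_one {ι : Type*} [Fintype ι] {p f : ι → ℝ} {C : ℝ}
    (hp : ∀ i, 0 ≤ p i) (hp1 : ∑ i, p i = 1) (hf : ∀ i, |f i| ≤ C) :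
    |∑ i, p i * f i| ≤ C :=
  calc |∑ i, p i * f i| ≤ ∑ i, |p i * f i| := Finset.abs_sum_le_sum_abs _ _
    _ ≤ ∑ i, p i * C := Finset.sum_le_sum fun i _ => by
        rw [abs_mul, abs_of_nonneg (hp i)]
        exact mul_le_mul_of_nonneg_left (hf i) (hp i)
    _ = C := by rw [← Finset.sum_mul, hp1, one_mul]

/-- the regularized Bellman operator is a sup-norm contraction with
modulus `γ/(1+λ) < 1`. -/
theorem bhat_contraction {S A : Type*} [Fintype S] [Fintype A] [Nonempty S] [Nonempty A]
    (P : S → A → S → ℝ) (R : S → A → ℝ) (γ lam : ℝ) (Qpi : S × A → ℝ)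
    (hP0 : ∀ s a s', 0 ≤ P s a s') (hP1 : ∀ s a, ∑ s', P s a s' = 1)
    (hγ0 : 0 ≤ γ) (hγ1 : γ < 1) (hlam : 0 < lam) :
    γ / (1 + lam) < 1 ∧
    ∀ Q₁ Q₂ : S × A → ℝ,
      ‖Bhat P R γ lam Qpi Q₁ - Bhat P R γ lam Qpi Q₂‖ ≤ (γ / (1 + lam)) * ‖Q₁ - Q₂‖ := by
  have hpos : 0 < 1 + lam := by linarith
  refine ⟨(div_lt_one hpos).2 (by linarith), fun Q₁ Q₂ => ?_⟩
  have hmod : 0 ≤ γ / (1 + lam) := div_nonneg hγ0 hpos.le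
  refine (pi_norm_le_iff_of_nonneg (mul_nonneg hmod (norm_nonneg _))).2 ?_
  rintro ⟨s, a⟩
  have hsub : (Bhat P R γ lam Qpi Q₁ - Bhat P R γ lam Qpi Q₂) (s, a) =
      γ / (1 + lam) * ∑ s', P s a s' * (maxQ Q₁ s' - maxQ Q₂ s') := by
    simp only [Pi.sub_apply, Bhat, mul_sub, Finset.sum_sub_distrib]
    ring
  rw [hsub, Real.norm_eq_abs, abs_mul, abs_of_nonneg hmod]
  exact mul_le_mul_of_nonneg_left
    (abs_sum_mul_le_of_sum_eq_one (hP0 s a) (hP1 s a) (abs_maxQ_sub_le Q₁ Q₂)) hmod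
end

section
/- (Lemma 3 of the paper.) Let S, A be finite nonempty sets, γ ∈ [0,1), and Rmax > 0. For i = 1,…,N let R_i : S×A → ℝ be rewards and P_i transition kernels, and let σ_{1,i}, σ_{2,i} ≥ 0 satisfy, for every (s,a): |R_i(s,a) − (1/N)Σ_{j=1}^N R_j(s,a)| ≤ σ_{1,i} and Σ_{s'∈S} |P_i(s'|s,a) − (1/N)Σ_{j=1}^N P_j(s'|s,a)| ≤ σ_{2,i}. Then for any tables Q̃_i : S×A → ℝ with ‖Q̃_i‖∞ ≤ Rmax/(1−γ) and any (s,a), (1/N)·Σ_{i=1}^N ( R_i(s,a) + γ·Σ_{s'} P_i(s'|s,a)·max_{a'} Q̃_i(s',a') − (1/N)·Σ_{j=1}^N ( R_j(s,a) + γ·Σ_{s'} P_j(s'|s,a)·max_{a'} Q̃_i(s',a') ) )² ≤ σ², where σ² = (1/N)·Σ_{i=1}^N ( σ_{1,i} + σ_{2,i}·γ·Rmax/(1−γ) )². -/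
open Finset

lemma abs_maxQ_le_norm {S A : Type*} [Fintype S] [Fintype A] [Nonempty A]
    (Q : S × A → ℝ) (s : S) : |maxQ Q s| ≤ ‖Q‖ := by
  obtain ⟨a, -, ha⟩ := Finset.exists_mem_eq_sup' Finset.univ_nonempty (fun a : A => Q (s, a))
  have h : maxQ Q s = Q (s, a) := ha
  rw [h, ← Real.norm_eq_abs]
  exact norm_le_pi_norm Q (s, a)

/-- Hölder's inequality for the ℓ¹ and ℓ^∞ norms of finite families. -/
lemma abs_sum_mul_le_of_abs_le {ι : Type*} [Fintype ι] {f g : ι → ℝ} {c d : ℝ}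
    (hf : ∑ x, |f x| ≤ c) (hg : ∀ x, |g x| ≤ d) (hd : 0 ≤ d) :
    |∑ x, f x * g x| ≤ c * d :=
  calc |∑ x, f x * g x| ≤ ∑ x, |f x * g x| := Finset.abs_sum_le_sum_abs _ _
    _ ≤ ∑ x, |f x| * d := Finset.sum_le_sum fun x _ => by
        rw [abs_mul]
        exact mul_le_mul_of_nonneg_left (hg x) (abs_nonneg _)
    _ = (∑ x, |f x|) * d := (Finset.sum_mul _ _ _).symm
    _ ≤ c * d := mul_le_mul_of_nonneg_right hf hd

/-- The deviation of an affine backup from a weighted aggregate splits into the deviation of the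
rewards and the deviation of the transitions. -/
lemma backup_sub_mul_sum_backup {ι S : Type*} [Fintype ι] [Fintype S] (w γ r₀ : ℝ)
    (p₀ : S → ℝ) (r : ι → ℝ) (p : ι → S → ℝ) (v : S → ℝ) :
    r₀ + γ * ∑ s, p₀ s * v s - w * ∑ j, (r j + γ * ∑ s, p j s * v s) =
      (r₀ - w * ∑ j, r j) + γ * ∑ s, (p₀ s - w * ∑ j, p j s) * v s := by
  have h : ∑ s, (p₀ s - w * ∑ j, p j s) * v s =
      ∑ s, p₀ s * v s - w * ∑ j, ∑ s, p j s * v s := by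
    rw [Finset.sum_comm, Finset.mul_sum, ← Finset.sum_sub_distrib]
    refine Finset.sum_congr rfl fun s _ => ?_
    rw [← Finset.sum_mul]
    ring
  rw [h, Finset.sum_add_distrib, ← Finset.mul_sum]
  ring

/-- Lemma 3 of the paper: under the diversity bounds on rewards and
transitions, for any tables `Q̃_i` with `‖Q̃_i‖∞ ≤ Rmax/(1−γ)` and any `(s,a)`,
the empirical variance of the Bellman backups across tasks is bounded by
`σ² = (1/N)·Σ_i (σ_{1,i} + σ_{2,i}·γ·Rmax/(1−γ))²`. -/
theorem task_backup_variance_bound {S A : Type*} [Fintype S] [Fintype A]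
    [Nonempty S] [Nonempty A]
    (N : ℕ) (hN : 1 ≤ N) (γ Rmax : ℝ) (hγ0 : 0 ≤ γ) (hγ1 : γ < 1) (hRmax : 0 < Rmax)
    (Rew : Fin N → S → A → ℝ) (P : Fin N → S → A → S → ℝ)
    (hP0 : ∀ i s a s', 0 ≤ P i s a s') (hP1 : ∀ i s a, ∑ s', P i s a s' = 1)
    (σ1 σ2 : Fin N → ℝ) (hσ1 : ∀ i, 0 ≤ σ1 i) (hσ2 : ∀ i, 0 ≤ σ2 i)
    (hRdiv : ∀ i s a, |Rew i s a - (1 / (N : ℝ)) * ∑ j, Rew j s a| ≤ σ1 i)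
    (hPdiv : ∀ i s a, ∑ s', |P i s a s' - (1 / (N : ℝ)) * ∑ j, P j s a s'| ≤ σ2 i)
    (Qt : Fin N → S × A → ℝ) (hQt : ∀ i, ‖Qt i‖ ≤ Rmax / (1 - γ))
    (s : S) (a : A) :
    (1 / (N : ℝ)) * ∑ i,
      (Rew i s a + γ * ∑ s', P i s a s' * maxQ (Qt i) s'
        - (1 / (N : ℝ)) * ∑ j, (Rew j s a + γ * ∑ s', P j s a s' * maxQ (Qt i) s'))^2
    ≤ (1 / (N : ℝ)) * ∑ i, (σ1 i + σ2 i * γ * Rmax / (1 - γ))^2 := by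
  have hB : 0 ≤ Rmax / (1 - γ) := div_nonneg hRmax.le (sub_nonneg.2 hγ1.le)
  refine mul_le_mul_of_nonneg_left (Finset.sum_le_sum fun i _ => ?_) (by positivity)
  rw [backup_sub_mul_sum_backup, ← sq_abs]
  refine pow_le_pow_left₀ (abs_nonneg _) ((abs_add_le _ _).trans ?_) 2
  have hP := abs_sum_mul_le_of_abs_le (hPdiv i s a)
    (fun s' => (abs_maxQ_le_norm (Qt i) s').trans (hQt i)) hB
  refine add_le_add (hRdiv i s a) ?_
  rw [abs_mul, abs_of_nonneg hγ0]
  exact (mul_le_mul_of_nonneg_left hP hγ0).trans_eq (by ring)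
end

section
/- (Per-round deterministic form of Theorem 2(b).) Let S, A be finite nonempty sets, γ ∈ [0,1), Rmax > 0, λ with λ² > 8, δ ≥ 0, and Qπ : S×A → ℝ with ‖Qπ‖∞ ≤ Rmax/(1−γ). For i = 1,…,N let R_i, P_i be task rewards and transition kernels with |R_i(s,a)| ≤ Rmax and diversity bounds |R_i(s,a) − (1/N)Σ_j R_j(s,a)| ≤ σ_{1,i} and Σ_{s'} |P_i(s'|s,a) − (1/N)Σ_j P_j(s'|s,a)| ≤ σ_{2,i} for all (s,a); let Q_i* be the unique fixed point of the task-i regularized Bellman operator B̂_i with ‖Q_i*‖∞ ≤ Rmax/(1−γ); let g_i = λ(Qπ − Q_i*) and ḡ = (1/N)Σ_i g_i; and let Q_i^{π_i} : S×A → ℝ be personalized tables with ‖Q_i^{π_i} − Q_i*‖∞ ≤ δ. Then for every (s,a): (1/N)·Σ_{i=1}^N ( Q_i^{π_i}(s,a) − Qπ(s,a) )² ≤ 2·δ² + (2/(λ²−8))·ḡ(s,a)² + (a constant multiple, namely (2/λ²) times the diversity term 2σ₂², of) 4·σ₂²/λ², i.e., ≤ 2δ² + (2/(λ²−8))·ḡ(s,a)²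 + 4σ₂²/λ², where σ₂² = (2λ²/(λ²−8))·σ² + (2λ²γ/((λ²−8)(1−γ)))·Rmax and σ² = (1/N)·Σ_{i=1}^N ( σ_{1,i} + σ_{2,i}·γ·Rmax/(1−γ) )². -/
open Finset

/-- `G` is an admissible ratio at `x`: it is small enough for the final variance estimate, and
every solution of the averaged envelope inequalities with bound `G` has a small total. -/
def AdmissibleRatio (x G : ℝ) : Prop :=
  0 ≤ G ∧ (x ^ 2 + 2 * x - 7) * (1 + G) ^ 2 ≤ 4 * x ^ 2 ∧
    ∀ U J K : ℝ, 0 ≤ J → 0 ≤ K →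
      (x ^ 2 - x - 1) * U ≤ (x + 1) - (x - 1) * K →
      2 * G * J * (x ^ 2 - 1) ≤ (x + 1) + x * U + J + K →
      2 * G * K * (x ^ 2 - 1) ≤ (x + 1) + U + x * (J + K) →
      U + J + K ≤ 2 * (x - 1) * G - 2

lemma quad_pos_of_gt {x : ℝ} (hx : 1.82 < x) : 0 < x ^ 2 - x - 1 := by nlinarith

lemma ratio_sq_bound {x g q : ℝ} (hx : 1.82 < x) (hq : q = x ^ 2 - x - 1)
    (h : (x ^ 2 + 2 * x - 7) * ((2 * x + 1) * (x - 1) + 2 * g * q + 2 * q * (x - 1)) ^ 2 ≤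
      16 * x ^ 2 * (q * (x - 1)) ^ 2) :
    (x ^ 2 + 2 * x - 7) * (1 + ((2 * x + 1) * (x - 1) + 2 * g * q) / (2 * (q * (x - 1)))) ^ 2
      ≤ 4 * x ^ 2 := by
  have hq0 : 0 < q := hq ▸ quad_pos_of_gt hx
  have hx1 : 0 < x - 1 := by linarith
  have hd : 0 < q * (x - 1) := mul_pos hq0 hx1
  have e : 1 + ((2 * x + 1) * (x - 1) + 2 * g * q) / (2 * (q * (x - 1))) =
      ((2 * x + 1) * (x - 1) + 2 * g * q + 2 * q * (x - 1)) / (2 * (q * (x - 1))) := by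
    field_simp [hx1.ne']
    ring
  rw [e, div_pow, mul_div_assoc', div_le_iff₀ (by positivity)]
  linarith

lemma admissibleRatio_half {x : ℝ} (hx : 1.82 < x) (h : x ≤ 2 ∨ 5 / 2 ≤ x) :
    ∃ G, AdmissibleRatio x G := by
  obtain ⟨q, hq⟩ : ∃ q, q = x ^ 2 - x - 1 := ⟨_, rfl⟩
  have hq0 : 0 < q := hq ▸ quad_pos_of_gt hx
  have hx1 : 0 < x - 1 := by linarith
  have hd : 0 < q * (x - 1) := mul_pos hq0 hx1
  refine ⟨((2 * x + 1) * (x - 1) + 2 * (1 / 2) * q) / (2 * (q * (x - 1))), ?_,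
    ratio_sq_bound hx hq ?_, ?_⟩
  · exact div_nonneg (by nlinarith) (by linarith)
  · subst hq
    have key : 0 ≤ 16 * (x ^ 3 - 2 * x ^ 2 + 1) ^ 2
        - (x ^ 2 + 2 * x - 7) * (2 * x ^ 2 - x - 2) ^ 2 := by
      rcases h with h | h
      · obtain ⟨z, rfl⟩ : ∃ z, x = 2 - z := ⟨2 - x, by ring⟩
        have hz : 0 ≤ z := by linarith
        have e : 16 * ((2 - z) ^ 3 - 2 * (2 - z) ^ 2 + 1) ^ 2
            - ((2 - z) ^ 2 + 2 * (2 - z) - 7) * (2 * (2 - z) ^ 2 - (2 - z) - 2) ^ 2 =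
            z * (24 - 33 * z - 70 * z ^ 2 + 147 * z ^ 3 - 76 * z ^ 4 + 12 * z ^ 5) := by ring
        rw [e]
        have hz' : z ≤ 1 / 5 := by linarith
        have h2 : z ^ 2 ≤ (1 / 5) ^ 2 := by gcongr
        have h4 : z ^ 4 ≤ (1 / 5) ^ 4 := by gcongr
        have h3 : 0 ≤ z ^ 3 := by positivity
        have h5 : 0 ≤ z ^ 5 := by positivity
        exact mul_nonneg hz (by linarith)
      · obtain ⟨z, rfl⟩ : ∃ z, x = 5 / 2 + z := ⟨x - 5 / 2, by ring⟩
        have hz : 0 ≤ z := by linarith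
        ring_nf
        positivity
    nlinarith [mul_nonneg (sq_nonneg x) key]
  · intro U J K hJ hK ha hb hc
    set G := ((2 * x + 1) * (x - 1) + 2 * (1 / 2) * q) / (2 * (q * (x - 1))) with hG
    have hGq : 2 * G * (q * (x - 1)) = (2 * x + 1) * (x - 1) + q := by
      rw [hG]; field_simp [hx1.ne']
    rw [← hq] at ha
    have h1 : (J + K) * (2 * G * (x - 1) - 1) ≤ 2 + U := by
      have : 0 < x + 1 := by linarith
      refine le_of_mul_le_mul_left ?_ this
      linarith
    have h2 : (J + K) * (2 * x ^ 2 - x - 1) ≤ 1 * (2 * x ^ 2 - x - 1) := by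
      have h3 := mul_le_mul_of_nonneg_left h1 hq0.le
      have h4 : q * ((J + K) * (2 * G * (x - 1) - 1)) = (J + K) * (2 * x ^ 2 - x - 1) := by
        linear_combination (J + K) * hGq
      have : 0 ≤ (x - 1) * K := mul_nonneg (by linarith) hK
      linarith
    have h5 : J + K ≤ 1 := le_of_mul_le_mul_right h2 (by nlinarith)
    refine le_of_mul_le_mul_left ?_ hq0
    have : 0 ≤ (x - 1) * K := mul_nonneg (by linarith) hK
    nlinarith

lemma admissibleRatio_of_bounds {x g j k q : ℝ} (hx : 2 ≤ x) (hg : 0 ≤ g)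
    (hq : q = x ^ 2 - x - 1)
    (hT : (x ^ 2 + 2 * x - 7) * ((2 * x + 1) * (x - 1) + 2 * g * q + 2 * q * (x - 1)) ^ 2 ≤
      16 * x ^ 2 * (q * (x - 1)) ^ 2)
    (hj : (x + 1) * (x ^ 2 - 1) ≤ j * ((x + 1) * ((2 * x + 1) * (x - 1) + 2 * g * q) - q))
    (hk : x * (x ^ 2 - 1) + x * q * j ≤
      k * ((x + 1) * ((2 * x + 1) * (x - 1) + 2 * g * q) - x * q + x - 1))
    (hs : q * j + (x ^ 2 - 2 * x) * k ≤ 2 * g * q) :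
    ∃ G, AdmissibleRatio x G := by
  have hq0 : 0 < q := hq ▸ quad_pos_of_gt (by linarith)
  have hx1 : 0 < x - 1 := by linarith
  have hd : 0 < q * (x - 1) := mul_pos hq0 hx1
  have hgq : 0 ≤ g * q := mul_nonneg hg hq0.le
  refine ⟨((2 * x + 1) * (x - 1) + 2 * g * q) / (2 * (q * (x - 1))), ?_,
    ratio_sq_bound (by linarith) hq hT, ?_⟩
  · exact div_nonneg (by nlinarith) (by linarith)
  · intro U J K hJ hK ha hb hc
    set G := ((2 * x + 1) * (x - 1) + 2 * g * q) / (2 * (q * (x - 1))) with hG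
    have hGq : 2 * G * (q * (x - 1)) = (2 * x + 1) * (x - 1) + 2 * g * q := by
      rw [hG]; field_simp [hx1.ne']
    rw [← hq] at ha
    have hgx : 0 ≤ (x + 1) * (2 * (g * q)) := mul_nonneg (by linarith) (by linarith)
    have hJj : J ≤ j := by
      refine le_of_mul_le_mul_right (le_trans ?_ hj) (by nlinarith)
      have h3 := mul_le_mul_of_nonneg_left hb hq0.le
      have h4 : q * (2 * G * J * (x ^ 2 - 1)) =
          J * ((x + 1) * ((2 * x + 1) * (x - 1) + 2 * g * q)) := by
        linear_combination J * (x + 1) * hGq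
      have h6 := mul_le_mul_of_nonneg_left ha (by linarith : 0 ≤ x)
      subst hq
      linarith
    have hKk : K ≤ k := by
      refine le_of_mul_le_mul_right (le_trans ?_ hk) (by nlinarith)
      have h3 := mul_le_mul_of_nonneg_left hc hq0.le
      have h4 : q * (2 * G * K * (x ^ 2 - 1)) =
          K * ((x + 1) * ((2 * x + 1) * (x - 1) + 2 * g * q)) := by
        linear_combination K * (x + 1) * hGq
      have h6 := mul_le_mul_of_nonneg_left hJj (mul_nonneg (by linarith : 0 ≤ x) hq0.le)
      subst hq
      linarith
    refine le_of_mul_le_mul_left ?_ hq0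
    have h7 := mul_le_mul_of_nonneg_left hJj hq0.le
    have h8 := mul_le_mul_of_nonneg_left hKk (by nlinarith : 0 ≤ x ^ 2 - 2 * x)
    subst hq
    linarith

lemma exists_admissibleRatio {x : ℝ} (hx : 1.82 < x) : ∃ G, AdmissibleRatio x G := by
  rcases le_or_gt x 2 with h2 | h2
  · exact admissibleRatio_half hx (Or.inl h2)
  rcases le_or_gt (5 / 2) x with h5 | h5
  · exact admissibleRatio_half hx (Or.inr h5)
  rcases le_or_gt x (11 / 5) with h3 | h3
  · refine admissibleRatio_of_bounds (g := 173 / 500) (j := 561 / 1000) (k := 12 / 25) h2.le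
      (by norm_num) rfl ?_ ?_ ?_ ?_
    · obtain ⟨y, rfl⟩ : ∃ y, x = 43 / 20 + y := ⟨x - 43 / 20, by ring⟩
      have hy : 0 ≤ y + 3 / 20 := by linarith
      have h3' : 0 ≤ y ^ 2 * (y + 3 / 20) := by positivity
      have h5' : 0 ≤ y ^ 4 * (y + 3 / 20) := by positivity
      have h7' : 0 ≤ y ^ 6 * (y + 3 / 20) := by positivity
      have h4' : 0 ≤ y ^ 4 := by positivity
      have h6' : 0 ≤ y ^ 6 := by positivity
      have h8' : 0 ≤ y ^ 8 := by positivity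
      have hsq := sq_nonneg (y - 1 / 125)
      linarith
    · obtain ⟨y, rfl⟩ : ∃ y, x = 2 + y := ⟨x - 2, by ring⟩
      have hy : 0 ≤ y := by linarith
      have hy2 : 0 ≤ y ^ 2 := by positivity
      have hy3 : 0 ≤ y ^ 3 := by positivity
      linarith
    · obtain ⟨y, rfl⟩ : ∃ y, x = 2 + y := ⟨x - 2, by ring⟩
      have hy : 0 ≤ y := by linarith
      have hy' : y ≤ 1 / 5 := by linarith
      have hy2 : y ^ 2 ≤ (1 / 5) ^ 2 := by gcongr
      have hy3 : y ^ 3 ≤ (1 / 5) ^ 3 := by gcongr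
      linarith
    · obtain ⟨y, rfl⟩ : ∃ y, x = 2 + y := ⟨x - 2, by ring⟩
      have hy : 0 ≤ y := by linarith
      have hy' : y ≤ 1 / 5 := by linarith
      have hy2 : y ^ 2 ≤ (1 / 5) ^ 2 := by gcongr
      linarith
  · refine admissibleRatio_of_bounds (g := 7 / 20 + 13 / 50 * (x - 11 / 5)) (j := 14 / 25)
      (k := 1 / 2) h2.le (by linarith) rfl ?_ ?_ ?_ ?_
    · obtain ⟨y, rfl⟩ : ∃ y, x = 221 / 100 + y := ⟨x - 221 / 100, by ring⟩
      have hy : 0 ≤ y + 1 / 100 := by linarith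
      have h3' : 0 ≤ y ^ 2 * (y + 1 / 100) := by positivity
      have h5' : 0 ≤ y ^ 4 * (y + 1 / 100) := by positivity
      have h7' : 0 ≤ y ^ 6 * (y + 1 / 100) := by positivity
      have h4' : 0 ≤ y ^ 4 := by positivity
      have h6' : 0 ≤ y ^ 6 := by positivity
      have h8' : 0 ≤ y ^ 8 := by positivity
      have hsq := sq_nonneg (y + 1 / 300)
      linarith
    · obtain ⟨y, rfl⟩ : ∃ y, x = 11 / 5 + y := ⟨x - 11 / 5, by ring⟩
      have hy : 0 ≤ y := by linarith
      have hy2 : 0 ≤ y ^ 2 := by positivity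
      have hy3 : 0 ≤ y ^ 3 := by positivity
      have hy4 : 0 ≤ y ^ 4 := by positivity
      linarith
    · obtain ⟨y, rfl⟩ : ∃ y, x = 11 / 5 + y := ⟨x - 11 / 5, by ring⟩
      have hy : 0 ≤ y := by linarith
      have hy' : y ≤ 3 / 10 := by linarith
      have hy2 : 0 ≤ y ^ 2 := by positivity
      have hy3 : 0 ≤ y ^ 3 := by positivity
      have hy4 : 0 ≤ y ^ 4 := by positivity
      linarith
    · obtain ⟨y, rfl⟩ : ∃ y, x = 11 / 5 + y := ⟨x - 11 / 5, by ring⟩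
      have hy : 0 ≤ y := by linarith
      have hy2 : 0 ≤ y ^ 2 := by positivity
      have hy3 : 0 ≤ y ^ 3 := by positivity
      linarith

open scoped BigOperators

lemma expect_affine_sq_le {ι : Type*} [Fintype ι] [Nonempty ι] (σ : ι → ℝ) {a b w : ℝ}
    (ha : 0 ≤ a) (hb : 0 ≤ b) (hw : 𝔼 i, σ i ≤ w) (hw2 : 𝔼 i, σ i ^ 2 = w ^ 2) :
    𝔼 i, (a * σ i + b) ^ 2 ≤ (a * w + b) ^ 2 := by
  have e : 𝔼 i, (a * σ i + b) ^ 2 = a ^ 2 * 𝔼 i, σ i ^ 2 + 2 * a * b * 𝔼 i, σ i + b ^ 2 := by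
    rw [Finset.mul_expect, Finset.mul_expect, ← Fintype.expect_const (ι := ι) (b ^ 2),
      ← Finset.expect_add_distrib, ← Finset.expect_add_distrib]
    exact Finset.expect_congr rfl fun i _ => by ring
  rw [e, hw2]
  nlinarith [mul_le_mul_of_nonneg_left hw (by positivity : 0 ≤ 2 * a * b)]

lemma expect_le_of_expect_sq_eq {ι : Type*} [Fintype ι] [Nonempty ι] (σ : ι → ℝ) {w : ℝ}
    (hw : 0 ≤ w) (hw2 : 𝔼 i, σ i ^ 2 = w ^ 2) : 𝔼 i, σ i ≤ w := by
  refine (abs_le_of_sq_le_sq' ?_ hw).2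
  have := Finset.expect_mul_sq_le_sq_mul_sq Finset.univ σ (fun _ => 1)
  simpa [hw2] using this

/-- Either the trivial radius `M`, or radii `t i` around a common shift `c` of the envelope
`[-l i, u i]`, give a small mean square. -/
def EnvelopeBound {ι : Type*} [Fintype ι] (σ u l : ι → ℝ) (M p y : ℝ) : Prop :=
  p * 𝔼 i, (σ i + M) ^ 2 ≤ 4 * y ^ 2 * 𝔼 i, σ i ^ 2 ∨
    ∃ (c : ℝ) (t : ι → ℝ), (∀ i, u i - c ≤ t i ∧ l i + c ≤ t i) ∧
      p * 𝔼 i, (σ i + t i) ^ 2 ≤ 4 * y ^ 2 * 𝔼 i, σ i ^ 2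

lemma exists_ratio_of_envelope {x w M U J K : ℝ} (hx : 1.82 < x) (hw : 0 ≤ w) (hM : 0 < M)
    (hJ : 0 ≤ J) (hK : 0 ≤ K)
    (ha : (x ^ 2 - x - 1) * U ≤ (x + 1) * w - (x - 1) * K)
    (hb : 2 * M * J * (x ^ 2 - 1) ≤ w * ((x + 1) * w + x * U + J + K))
    (hc : 2 * M * K * (x ^ 2 - 1) ≤ w * ((x + 1) * w + U + x * (J + K))) :
    ∃ G, 0 ≤ G ∧ (x ^ 2 + 2 * x - 7) * (1 + G) ^ 2 ≤ 4 * x ^ 2 ∧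
      (M ≤ G * w ∨ x * w + (U + J + K) / 2 ≤ (x - 1) * (1 + G) * w) := by
  obtain ⟨G, hG, hG2, hG3⟩ := exists_admissibleRatio hx
  refine ⟨G, hG, hG2, ?_⟩
  rw [or_iff_not_imp_left, not_le]
  intro hMG
  have hx2 : 0 < x ^ 2 - 1 := by nlinarith
  rcases hw.eq_or_lt with rfl | hw
  · have hMx : 0 < 2 * M * (x ^ 2 - 1) := by positivity
    have hJ0 : J ≤ 0 := by
      refine le_of_mul_le_mul_left ?_ hMx
      linarith
    have hK0 : K ≤ 0 := by
      refine le_of_mul_le_mul_left ?_ hMx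
      linarith
    obtain rfl : J = 0 := le_antisymm hJ0 hJ
    obtain rfl : K = 0 := le_antisymm hK0 hK
    have hU : U ≤ 0 := by
      refine le_of_mul_le_mul_left ?_ (quad_pos_of_gt hx)
      linarith
    linarith
  · have scale : ∀ {V R : ℝ}, 0 ≤ V → 2 * M * V * (x ^ 2 - 1) ≤ w * R →
        2 * G * (V / w) * (x ^ 2 - 1) ≤ R / w := by
      intro V R hV h
      have h1 : 2 * (G * w) * V * (x ^ 2 - 1) ≤ w * R :=
        le_trans (by gcongr) h
      rw [le_div_iff₀ hw]
      have h2 : 2 * G * (V / w) * (x ^ 2 - 1) * w = 2 * G * V * (x ^ 2 - 1) := by field_simp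
      rw [h2]
      refine le_of_mul_le_mul_left ?_ hw
      linarith
    have h := hG3 (U / w) (J / w) (K / w) (by positivity) (by positivity) ?_ ?_ ?_
    · rw [← add_div, ← add_div, div_le_iff₀ hw] at h
      linarith
    · have e : (x + 1) - (x - 1) * (K / w) = ((x + 1) * w - (x - 1) * K) / w := by field_simp
      rw [e, mul_div_assoc']
      gcongr
    · refine (scale hJ hb).trans_eq ?_
      field_simp
    · refine (scale hK hc).trans_eq ?_
      field_simp

lemma envelopeBound_of_neg {ι : Type*} [Fintype ι] [Nonempty ι] {σ u l h : ι → ℝ} {x M : ℝ}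
    (hx : 1.82 < x) (hp : 0 < x ^ 2 + 2 * x - 7) (hM : 0 < M)
    (hu : ∀ i, 0 ≤ u i) (hl : ∀ i, 0 ≤ l i)
    (hh : ∀ i, 0 ≤ h i) (hσ : ∀ i, 2 * h i * M ≤ σ i)
    (hxu : ∀ i, x * u i ≤ σ i + l i - h i * l i + 𝔼 j, u j)
    (hxl : ∀ i, x * l i ≤ σ i + u i - h i * u i + 𝔼 j, h j * (u j + l j)) :
    EnvelopeBound σ u l M (x ^ 2 + 2 * x - 7) x := by
  have hσ0 : ∀ i, 0 ≤ σ i := fun i => le_trans (by have := hh i; positivity) (hσ i)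
  set w := √(𝔼 i, σ i ^ 2) with hwdef
  have hw : 0 ≤ w := Real.sqrt_nonneg _
  have hw2 : 𝔼 i, σ i ^ 2 = w ^ 2 :=
    (Real.sq_sqrt (Finset.expect_nonneg fun i _ => sq_nonneg _)).symm
  have hσw := expect_le_of_expect_sq_eq σ hw hw2
  set U := 𝔼 j, u j with hU
  set J := 𝔼 j, h j * u j with hJ
  set K := 𝔼 j, h j * l j with hK
  have hH : 𝔼 j, h j * (u j + l j) = J + K := by
    rw [hJ, hK, ← Finset.expect_add_distrib]
    exact Finset.expect_congr rfl fun i _ => by ring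
  rw [hH] at hxl
  have hU0 : 0 ≤ U := Finset.expect_nonneg fun i _ => hu i
  have hJ0 : 0 ≤ J := Finset.expect_nonneg fun i _ => mul_nonneg (hh i) (hu i)
  have hK0 : 0 ≤ K := Finset.expect_nonneg fun i _ => mul_nonneg (hh i) (hl i)
  have mean_u : x * U ≤ 𝔼 i, σ i + 𝔼 i, l i - K + U := by
    have := Finset.expect_le_expect (s := Finset.univ) fun i _ => hxu i
    simpa only [Finset.expect_add_distrib, Finset.expect_sub_distrib, ← Finset.mul_expect,
      Fintype.expect_const] using this
  have mean_l : x * 𝔼 i, l i ≤ 𝔼 i, σ i + U - J + (J + K) := by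
    have := Finset.expect_le_expect (s := Finset.univ) fun i _ => hxl i
    simpa only [Finset.expect_add_distrib, Finset.expect_sub_distrib, ← Finset.mul_expect,
      Fintype.expect_const] using this
  have ha : (x ^ 2 - x - 1) * U ≤ (x + 1) * w - (x - 1) * K := by
    nlinarith
  have hx2 : 0 < x ^ 2 - 1 := by nlinarith
  -- `h ≤ σ / (2 M)` turns a pointwise affine bound on `v` into a bound on the mean of `h v`
  have weighted : ∀ (v : ι → ℝ) (C : ℝ), (∀ i, 0 ≤ v i) → 0 ≤ C →
      (∀ i, (x ^ 2 - 1) * v i ≤ (x + 1) * σ i + C) →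
      2 * M * (𝔼 i, h i * v i) * (x ^ 2 - 1) ≤ w * ((x + 1) * w + C) := by
    intro v C hv hC hvC
    have h1 : ∀ i, 2 * M * (x ^ 2 - 1) * (h i * v i) ≤ (x + 1) * σ i ^ 2 + C * σ i := by
      intro i
      have h2 := mul_le_mul_of_nonneg_right (hσ i) (mul_nonneg hx2.le (hv i))
      have h3 := mul_le_mul_of_nonneg_left (hvC i) (hσ0 i)
      linarith
    have h4 := Finset.expect_le_expect (s := Finset.univ) fun i _ => h1 i
    rw [Finset.expect_add_distrib, ← Finset.mul_expect, ← Finset.mul_expect,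
      ← Finset.mul_expect, hw2] at h4
    have h5 := mul_le_mul_of_nonneg_left hσw hC
    linarith
  have hb : 2 * M * J * (x ^ 2 - 1) ≤ w * ((x + 1) * w + (x * U + J + K)) := by
    refine weighted u _ hu (by positivity) fun i => ?_
    have h1 := mul_le_mul_of_nonneg_left (hxu i) (by linarith : 0 ≤ x)
    have h2 : 0 ≤ h i * u i := mul_nonneg (hh i) (hu i)
    have h3 : 0 ≤ x * (h i * l i) := mul_nonneg (by linarith) (mul_nonneg (hh i) (hl i))
    linarith [hxl i]
  have hc : 2 * M * K * (x ^ 2 - 1) ≤ w * ((x + 1) * w + (U + x * (J + K))) := by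
    refine weighted l _ hl (by positivity) fun i => ?_
    have h1 := mul_le_mul_of_nonneg_left (hxl i) (by linarith : 0 ≤ x)
    have h2 : 0 ≤ h i * l i := mul_nonneg (hh i) (hl i)
    have h3 : 0 ≤ x * (h i * u i) := mul_nonneg (by linarith) (mul_nonneg (hh i) (hu i))
    linarith [hxu i]
  obtain ⟨G, hG, hG2, hG3⟩ := exists_ratio_of_envelope hx hw hM hJ0 hK0 ha
    (by linarith) (by linarith)
  have finish : ∀ a b : ℝ, 0 ≤ a → 0 ≤ b → a * w + b ≤ (1 + G) * w →
      (x ^ 2 + 2 * x - 7) * 𝔼 i, (a * σ i + b) ^ 2 ≤ 4 * x ^ 2 * 𝔼 i, σ i ^ 2 := by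
    intro a b ha hb hab
    calc (x ^ 2 + 2 * x - 7) * 𝔼 i, (a * σ i + b) ^ 2
        ≤ (x ^ 2 + 2 * x - 7) * ((1 + G) * w) ^ 2 := by
          refine mul_le_mul_of_nonneg_left ?_ hp.le
          exact (expect_affine_sq_le σ ha hb hσw hw2).trans (by gcongr)
      _ = (x ^ 2 + 2 * x - 7) * (1 + G) ^ 2 * w ^ 2 := by ring
      _ ≤ 4 * x ^ 2 * 𝔼 i, σ i ^ 2 := by rw [hw2]; gcongr
  have hx1 : 0 < x - 1 := by linarith
  rcases hG3 with hMG | hG3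
  · left
    simpa only [one_mul] using finish 1 M zero_le_one hM.le (by linarith)
  · right
    have ht : ∀ i, σ i + (σ i + (U + J + K) / 2) / (x - 1) =
        x / (x - 1) * σ i + (U + J + K) / 2 / (x - 1) := by
      intro i
      field_simp
      ring
    refine ⟨(U - (J + K)) / (2 * (x + 1)), fun i => (σ i + (U + J + K) / 2) / (x - 1), ?_, ?_⟩
    · intro i
      set c := (U - (J + K)) / (2 * (x + 1)) with hc
      have hcx : (x + 1) * c = (U - (J + K)) / 2 := by
        rw [hc]
        field_simp
      have h1 : 0 ≤ h i * u i := mul_nonneg (hh i) (hu i)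
      have h2 : 0 ≤ h i * l i := mul_nonneg (hh i) (hl i)
      rw [le_div_iff₀ hx1, le_div_iff₀ hx1]
      have h3 := hxu i
      have h4 := hxl i
      have key : ∀ a b r : ℝ, x * a ≤ r + b → x * b ≤ r + a → a * (x - 1) ≤ r := by
        intro a b r h5 h6
        nlinarith
      exact ⟨key _ (l i + c) _ (by linarith) (by linarith),
        key _ (u i - c) _ (by linarith) (by linarith)⟩
    · simp only [ht]
      refine finish _ _ (by positivity) (by positivity) ?_
      rw [div_mul_eq_mul_div, ← add_div, div_le_iff₀ hx1]
      linarith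

lemma envelopeBound_of_pos {ι : Type*} [Fintype ι] [Nonempty ι] {σ d : ι → ℝ} {y M : ℝ}
    (hy : 3.82 < y) (hp : 0 ≤ y ^ 2 - 2 * y - 7) (hd : ∀ i, 0 ≤ d i)
    (hyd : ∀ i, y * d i ≤ σ i + d i + 𝔼 j, d j) :
    EnvelopeBound σ d d M (y ^ 2 - 2 * y - 7) y := by
  right
  set w := √(𝔼 i, σ i ^ 2) with hwdef
  have hw : 0 ≤ w := Real.sqrt_nonneg _
  have hw2 : 𝔼 i, σ i ^ 2 = w ^ 2 :=
    (Real.sq_sqrt (Finset.expect_nonneg fun i _ => sq_nonneg _)).symm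
  have hσw := expect_le_of_expect_sq_eq σ hw hw2
  set D := 𝔼 j, d j with hD
  have hD0 : 0 ≤ D := Finset.expect_nonneg fun i _ => hd i
  have mean_d : y * D ≤ 𝔼 i, σ i + D + D := by
    have := Finset.expect_le_expect (s := Finset.univ) fun i _ => hyd i
    simpa only [Finset.expect_add_distrib, ← Finset.mul_expect, Fintype.expect_const] using this
  have hy1 : 0 < y - 1 := by linarith
  have hy2 : 0 < y - 2 := by linarith
  refine ⟨0, fun i => (σ i + D) / (y - 1), fun i => ?_, ?_⟩
  · rw [le_div_iff₀ hy1, le_div_iff₀ hy1]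
    constructor <;> linarith [hyd i]
  · have ht : ∀ i, σ i + (σ i + D) / (y - 1) = y / (y - 1) * σ i + D / (y - 1) := by
      intro i
      field_simp
      ring
    simp only [ht]
    have h1 := expect_affine_sq_le σ (a := y / (y - 1)) (b := D / (y - 1)) (by positivity)
      (by positivity) hσw hw2
    have h2 : y / (y - 1) * w + D / (y - 1) ≤ (y - 1) / (y - 2) * w := by
      have h3 : D ≤ w / (y - 2) := by
        rw [le_div_iff₀ hy2]
        linarith
      calc y / (y - 1) * w + D / (y - 1) ≤ y / (y - 1) * w + w / (y - 2) / (y - 1) := by gcongr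
        _ = (y - 1) / (y - 2) * w := by field_simp; ring
    calc (y ^ 2 - 2 * y - 7) * 𝔼 i, (y / (y - 1) * σ i + D / (y - 1)) ^ 2
        ≤ (y ^ 2 - 2 * y - 7) * ((y - 1) / (y - 2) * w) ^ 2 := by
          refine mul_le_mul_of_nonneg_left (h1.trans ?_) hp
          gcongr
      _ = (y ^ 2 - 2 * y - 7) * (y - 1) ^ 2 / (y - 2) ^ 2 * w ^ 2 := by
          rw [mul_pow, div_pow]
          ring
      _ ≤ 4 * y ^ 2 * 𝔼 i, σ i ^ 2 := by
          rw [hw2]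
          gcongr
          rw [div_le_iff₀ (by positivity)]
          have hv : 0 ≤ y * (y - 2) := by positivity
          nlinarith

section MeanDeviation

variable {ι S : Type*} [Fintype ι] [Fintype S]

lemma sum_mul_sub_sum_mul_le {p q f g : S → ℝ} {u h M : ℝ} (hp0 : ∀ s, 0 ≤ p s)
    (hp1 : ∑ s, p s = 1) (hq0 : ∀ s, 0 ≤ q s) (hq1 : ∑ s, q s = 1)
    (hpq : ∑ s, |p s - q s| ≤ 2 * h) (hfg : ∀ s, f s - g s ≤ u) (hf : ∀ s, f s ≤ M)
    (hg : ∀ s, -M ≤ g s) (huM : u ≤ 2 * M) :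
    ∑ s, p s * f s - ∑ s, q s * g s ≤ u + h * (2 * M - u) := by
  have point : ∀ s, p s * f s - q s * g s ≤
      q s * u + |p s - q s| * M - (|p s - q s| - (p s - q s)) / 2 * u := by
    intro s
    rcases le_total 0 (p s - q s) with h1 | h1
    · rw [abs_of_nonneg h1]
      nlinarith [mul_le_mul_of_nonneg_left (hfg s) (hq0 s), mul_le_mul_of_nonneg_left (hf s) h1]
    · rw [abs_of_nonpos h1]
      nlinarith [mul_le_mul_of_nonneg_left (hfg s) (hp0 s),
        mul_le_mul_of_nonneg_left (hg s) (neg_nonneg.2 h1)]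
  have total := Finset.sum_le_sum fun s (_ : s ∈ Finset.univ) => point s
  simp only [Finset.sum_sub_distrib, Finset.sum_add_distrib, ← Finset.sum_mul,
    ← Finset.sum_div, hp1, hq1] at total
  nlinarith [mul_le_mul_of_nonneg_right hpq (sub_nonneg.2 huM)]

lemma expect_sum_mul_sub {p V : ι → S → ℝ} {W : S → ℝ} :
    𝔼 j, ∑ s, p j s * V j s - ∑ s, (𝔼 j, p j s) * W s =
      𝔼 j, ∑ s, p j s * (V j s - W s) := by
  simp only [mul_sub, Finset.sum_sub_distrib, Finset.expect_sub_distrib]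
  rw [Finset.expect_sum_comm (f := fun j s => p j s * W s)]
  simp only [Finset.expect_mul]

lemma expect_sum_mul_le {p X : ι → S → ℝ} {u : ι → ℝ} (hp0 : ∀ j s, 0 ≤ p j s)
    (hp1 : ∀ j, ∑ s, p j s = 1) (hX : ∀ j s, X j s ≤ u j) :
    𝔼 j, ∑ s, p j s * X j s ≤ 𝔼 j, u j := by
  refine Finset.expect_le_expect fun j _ => ?_
  calc ∑ s, p j s * X j s ≤ ∑ s, p j s * u j :=
        Finset.sum_le_sum fun s _ => mul_le_mul_of_nonneg_left (hX j s) (hp0 j s)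
    _ = u j := by rw [← Finset.sum_mul, hp1, one_mul]

lemma sum_expect_eq_one [Nonempty ι] {p : ι → S → ℝ} (hp1 : ∀ j, ∑ s, p j s = 1) :
    ∑ s, 𝔼 j, p j s = 1 := by
  rw [← Finset.expect_sum_comm]
  simp only [hp1, Fintype.expect_const]

lemma neg_expect_le_expect_sum_mul [Nonempty ι] {p X : ι → S → ℝ} {u l h : ι → ℝ}
    (hp0 : ∀ j s, 0 ≤ p j s) (hp1 : ∀ j, ∑ s, p j s = 1)
    (hpdiv : ∀ i, ∑ s, |p i s - 𝔼 j, p j s| ≤ 2 * h i)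
    (hu : ∀ j, 0 ≤ u j) (hl : ∀ j, 0 ≤ l j)
    (hXu : ∀ j s, X j s ≤ u j) (hXl : ∀ j s, -l j ≤ X j s) (hX : ∀ s, 0 ≤ 𝔼 j, X j s) :
    -𝔼 j, h j * (u j + l j) ≤ 𝔼 j, ∑ s, p j s * X j s := by
  have centered : ∀ i, -(h i * (u i + l i)) ≤ ∑ s, (p i s - 𝔼 j, p j s) * X i s := by
    intro i
    have point : ∀ s, (p i s - 𝔼 j, p j s) * ((u i - l i) / 2) -
        |p i s - 𝔼 j, p j s| * ((u i + l i) / 2) ≤ (p i s - 𝔼 j, p j s) * X i s := by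
      intro s
      rcases le_total 0 (p i s - 𝔼 j, p j s) with h1 | h1
      · rw [abs_of_nonneg h1]
        nlinarith [mul_le_mul_of_nonneg_left (hXl i s) h1]
      · rw [abs_of_nonpos h1]
        nlinarith [mul_le_mul_of_nonneg_left (hXu i s) (neg_nonneg.2 h1)]
    refine le_trans ?_ (Finset.sum_le_sum fun s _ => point s)
    rw [Finset.sum_sub_distrib, ← Finset.sum_mul, ← Finset.sum_mul, Finset.sum_sub_distrib,
      hp1, sum_expect_eq_one hp1]
    have := mul_le_mul_of_nonneg_right (hpdiv i)
      (div_nonneg (add_nonneg (hu i) (hl i)) zero_le_two)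
    linarith
  have mean : 0 ≤ 𝔼 i, ∑ s, (𝔼 j, p j s) * X i s := by
    rw [Finset.expect_sum_comm]
    refine Finset.sum_nonneg fun s _ => ?_
    rw [← Finset.mul_expect]
    exact mul_nonneg (Finset.expect_nonneg fun j _ => hp0 j s) (hX s)
  have total := Finset.expect_le_expect (s := Finset.univ) fun i _ => centered i
  simp only [sub_mul, Finset.sum_sub_distrib, Finset.expect_sub_distrib,
    Finset.expect_neg_distrib] at total
  linarith

lemma backup_sub_expect_le [Nonempty ι] {r s₁ h u : ι → ℝ} {p V : ι → S → ℝ} {W : S → ℝ}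
    {γ M H : ℝ} (hγ : 0 ≤ γ) (hr : ∀ i, |r i - 𝔼 j, r j| ≤ s₁ i)
    (hp0 : ∀ j s, 0 ≤ p j s) (hp1 : ∀ j, ∑ s, p j s = 1)
    (hpdiv : ∀ i, ∑ s, |p i s - 𝔼 j, p j s| ≤ 2 * h i)
    (hV : ∀ i s, |V i s| ≤ M) (hW : ∀ s, |W s| ≤ M) (huM : ∀ i, u i ≤ 2 * M)
    (hVW : ∀ i s, V i s - W s ≤ u i) (hH : -H ≤ 𝔼 j, ∑ s, p j s * (V j s - W s)) (i : ι) :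
    (r i + γ * ∑ s, p i s * V i s) - 𝔼 j, (r j + γ * ∑ s, p j s * V j s) ≤
      s₁ i + 2 * γ * h i * M + γ * (u i - h i * u i + H) := by
  have gap := sum_mul_sub_sum_mul_le (hp0 i) (hp1 i)
    (fun s => Finset.expect_nonneg fun j _ => hp0 j s) (sum_expect_eq_one hp1) (hpdiv i)
    (hVW i) (fun s => (abs_le.1 (hV i s)).2) (fun s => (abs_le.1 (hW s)).1) (huM i)
  rw [← expect_sum_mul_sub] at hH
  rw [Finset.expect_add_distrib, ← Finset.mul_expect]
  have key : ∑ s, p i s * V i s - 𝔼 j, ∑ s, p j s * V j s ≤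
      2 * h i * M + (u i - h i * u i + H) := by linarith
  have := mul_le_mul_of_nonneg_left key hγ
  linarith [(abs_le.1 (hr i)).2]

lemma expect_sub_backup_le [Nonempty ι] {r s₁ h l : ι → ℝ} {p V : ι → S → ℝ} {W : S → ℝ}
    {γ M U : ℝ} (hγ : 0 ≤ γ) (hr : ∀ i, |r i - 𝔼 j, r j| ≤ s₁ i)
    (hp0 : ∀ j s, 0 ≤ p j s) (hp1 : ∀ j, ∑ s, p j s = 1)
    (hpdiv : ∀ i, ∑ s, |p i s - 𝔼 j, p j s| ≤ 2 * h i)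
    (hV : ∀ i s, |V i s| ≤ M) (hW : ∀ s, |W s| ≤ M) (hlM : ∀ i, l i ≤ 2 * M)
    (hWV : ∀ i s, W s - V i s ≤ l i) (hU : 𝔼 j, ∑ s, p j s * (V j s - W s) ≤ U) (i : ι) :
    𝔼 j, (r j + γ * ∑ s, p j s * V j s) - (r i + γ * ∑ s, p i s * V i s) ≤
      s₁ i + 2 * γ * h i * M + γ * (l i - h i * l i + U) := by
  have := backup_sub_expect_le (r := fun i => -r i) (V := fun i s => -V i s) (W := fun s => -W s)
    (H := U) hγ (fun i => by simpa [Finset.expect_neg_distrib, neg_add_eq_sub, abs_sub_comm]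
      using hr i) hp0 hp1 hpdiv (by simpa using hV) (by simpa using hW) hlM
    (fun i s => by linarith [hWV i s]) (by
      simp only [neg_sub_neg]
      have e : ∀ j, ∑ s, p j s * (W s - V j s) = -∑ s, p j s * (V j s - W s) := fun j => by
        rw [← Finset.sum_neg_distrib]
        exact Finset.sum_congr rfl fun s _ => by ring
      simp only [e, Finset.expect_neg_distrib]
      linarith) i
  simp only [mul_neg, Finset.sum_neg_distrib, Finset.expect_add_distrib,
    Finset.expect_neg_distrib] at this ⊢
  linarith

lemma expect_sub_expect_sq_le [Nonempty ι] (Y : ι → ℝ) (a : ℝ) :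
    𝔼 i, (Y i - 𝔼 j, Y j) ^ 2 ≤ 𝔼 i, (Y i - a) ^ 2 := by
  set m := 𝔼 j, Y j with hm
  have e : 𝔼 i, (Y i - a) ^ 2 = 𝔼 i, (Y i - m) ^ 2 + (m - a) ^ 2 := by
    have e1 : ∀ i, (Y i - a) ^ 2 = (Y i - m) ^ 2 + (2 * (m - a) * (Y i - m) + (m - a) ^ 2) :=
      fun i => by ring
    simp only [e1, Finset.expect_add_distrib, ← Finset.mul_expect, Finset.expect_sub_distrib,
      Fintype.expect_const, ← hm]
    ring
  rw [e]
  exact le_add_of_nonneg_right (sq_nonneg _)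

lemma expect_backup_sub_sq_le [Nonempty ι] {r s₁ s₂ t : ι → ℝ} {p V : ι → S → ℝ} {W : S → ℝ}
    {γ M : ℝ} (hγ0 : 0 ≤ γ) (hγ1 : γ ≤ 1) (hM : 0 ≤ M) (hr : ∀ i, |r i - 𝔼 j, r j| ≤ s₁ i)
    (hp0 : ∀ j s, 0 ≤ p j s) (hp1 : ∀ j, ∑ s, p j s = 1)
    (hpdiv : ∀ i, ∑ s, |p i s - 𝔼 j, p j s| ≤ s₂ i)
    (hV : ∀ i s, |V i s| ≤ M) (hVW : ∀ i s, |V i s - W s| ≤ t i) (ht : ∀ i, 0 ≤ t i) :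
    𝔼 i, ((r i + γ * ∑ s, p i s * V i s) - 𝔼 j, (r j + γ * ∑ s, p j s * V j s)) ^ 2 ≤
      𝔼 i, (s₁ i + s₂ i * γ * M + t i) ^ 2 := by
  refine (expect_sub_expect_sq_le _ (𝔼 j, r j + γ * ∑ s, (𝔼 j, p j s) * W s)).trans
    (Finset.expect_le_expect fun i _ => sq_le_sq' ?_ ?_)
  all_goals
    have h1 : |∑ s, (p i s - 𝔼 j, p j s) * V i s| ≤ s₂ i * M := by
      refine (Finset.abs_sum_le_sum_abs _ _).trans ?_
      calc ∑ s, |(p i s - 𝔼 j, p j s) * V i s| ≤ ∑ s, |p i s - 𝔼 j, p j s| * M := by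
            refine Finset.sum_le_sum fun s _ => ?_
            rw [abs_mul]
            exact mul_le_mul_of_nonneg_left (hV i s) (abs_nonneg _)
        _ ≤ s₂ i * M := by
            rw [← Finset.sum_mul]
            exact mul_le_mul_of_nonneg_right (hpdiv i) hM
    have h2 : |∑ s, (𝔼 j, p j s) * (V i s - W s)| ≤ t i := by
      have hq0 : ∀ s, 0 ≤ 𝔼 j, p j s := fun s => Finset.expect_nonneg fun j _ => hp0 j s
      refine (Finset.abs_sum_le_sum_abs _ _).trans ?_
      calc ∑ s, |(𝔼 j, p j s) * (V i s - W s)| ≤ ∑ s, (𝔼 j, p j s) * t i := by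
            refine Finset.sum_le_sum fun s _ => ?_
            rw [abs_mul, abs_of_nonneg (hq0 s)]
            exact mul_le_mul_of_nonneg_left (hVW i s) (hq0 s)
        _ = t i := by rw [← Finset.sum_mul, sum_expect_eq_one hp1, one_mul]
    have e : ∑ s, p i s * V i s - ∑ s, (𝔼 j, p j s) * W s =
        ∑ s, (p i s - 𝔼 j, p j s) * V i s + ∑ s, (𝔼 j, p j s) * (V i s - W s) := by
      rw [← Finset.sum_sub_distrib, ← Finset.sum_add_distrib]
      exact Finset.sum_congr rfl fun s _ => by ring
    have h3 := abs_le.1 (hr i)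
    have h4 := abs_le.1 h1
    have h5 := abs_le.1 h2
    have h6 : γ * t i ≤ t i := mul_le_of_le_one_left (ht i) hγ1
    have h7 := mul_le_mul_of_nonneg_left (add_le_add h4.2 h5.2) hγ0
    have h8 := mul_le_mul_of_nonneg_left (add_le_add h4.1 h5.1) hγ0
    rw [← e] at h7 h8
    linarith

end MeanDeviation

section MaxQ

variable {ι S A : Type*} [Fintype A] [Nonempty A]

lemma maxQ_sub_le_s16 {Q Q' : S × A → ℝ} {c : ℝ} (h : ∀ sa, Q sa - Q' sa ≤ c) (s : S) :
    maxQ Q s - maxQ Q' s ≤ c := by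
  rw [sub_le_iff_le_add]
  refine Finset.sup'_le _ _ fun a _ => ?_
  have : Q' (s, a) ≤ maxQ Q' s := Finset.le_sup' (fun a => Q' (s, a)) (Finset.mem_univ a)
  linarith [h (s, a)]

lemma abs_maxQ_le {Q : S × A → ℝ} {M : ℝ} (h : ∀ sa, |Q sa| ≤ M) (s : S) : |maxQ Q s| ≤ M := by
  have zero : maxQ (fun _ : S × A => (0 : ℝ)) s = 0 := by simp [maxQ]
  have h1 := maxQ_sub_le_s16 (Q := Q) (Q' := fun _ => 0) (c := M)
    (fun sa => by linarith [(abs_le.1 (h sa)).2]) s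
  have h2 := maxQ_sub_le_s16 (Q := fun _ => 0) (Q' := Q) (c := M)
    (fun sa => by linarith [(abs_le.1 (h sa)).1]) s
  rw [zero] at h1 h2
  exact abs_le.2 ⟨by linarith, by linarith⟩

lemma maxQ_expect_le [Fintype ι] (Q : ι → S × A → ℝ) (s : S) :
    maxQ (fun sa => 𝔼 i, Q i sa) s ≤ 𝔼 i, maxQ (Q i) s :=
  Finset.sup'_le _ _ fun a _ => Finset.expect_le_expect fun i _ =>
    Finset.le_sup' (fun a => Q i (s, a)) (Finset.mem_univ a)

end MaxQ

/-- The least nonnegative upper bound of a function on a finite type. -/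
noncomputable def posSup {X : Type*} [Fintype X] [Nonempty X] (f : X → ℝ) : ℝ :=
  Finset.univ.sup' Finset.univ_nonempty fun x => max 0 (f x)

section PosSup

variable {X : Type*} [Fintype X] [Nonempty X] {f : X → ℝ}

lemma le_max_posSup (x : X) : max 0 (f x) ≤ posSup f :=
  Finset.le_sup' (fun x => max 0 (f x)) (Finset.mem_univ x)

lemma le_posSup (x : X) : f x ≤ posSup f := (le_max_right _ _).trans (le_max_posSup x)

lemma posSup_nonneg : 0 ≤ posSup f :=
  (le_max_left _ _).trans (le_max_posSup (Classical.arbitrary X))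

lemma posSup_le {c : ℝ} (hc : 0 ≤ c) (h : ∀ x, f x ≤ c) : posSup f ≤ c :=
  Finset.sup'_le _ _ fun x _ => max_le hc (h x)

lemma mul_posSup_le {c y : ℝ} (hy : 0 < y) (hc : 0 ≤ c) (h : ∀ x, y * f x ≤ c) :
    y * posSup f ≤ c := by
  rw [← le_div_iff₀' hy]
  exact posSup_le (div_nonneg hc hy.le) fun x => (le_div_iff₀' hy).2 (h x)

end PosSup

lemma expect_sub_expect_sq_le_of_envelope {ι S : Type*} [Fintype ι] [Nonempty ι] [Fintype S]
    [Nonempty S] {r s₁ s₂ u l : ι → ℝ} {p V : ι → S → ℝ} {W : S → ℝ} {γ M η k q : ℝ} {x : ι → ℝ}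
    (hγ0 : 0 ≤ γ) (hγ1 : γ ≤ 1) (hM : 0 ≤ M) (hη : η ≠ 0) (hk : 0 ≤ k)
    (hr : ∀ i, |r i - 𝔼 j, r j| ≤ s₁ i)
    (hp0 : ∀ j s, 0 ≤ p j s) (hp1 : ∀ j, ∑ s, p j s = 1)
    (hpdiv : ∀ i, ∑ s, |p i s - 𝔼 j, p j s| ≤ s₂ i)
    (hV : ∀ i s, |V i s| ≤ M) (hVW : ∀ i s, V i s - W s ≤ u i) (hWV : ∀ i s, W s - V i s ≤ l i)
    (hx : ∀ i, η * x i = q + (r i + γ * ∑ s, p i s * V i s))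
    (henv : EnvelopeBound (fun i => s₁ i + s₂ i * γ * M) u l M k η) :
    k * 𝔼 i, (x i - 𝔼 j, x j) ^ 2 ≤ 4 * 𝔼 i, (s₁ i + s₂ i * γ * M) ^ 2 := by
  set w := 𝔼 i, (s₁ i + s₂ i * γ * M) ^ 2 with hw
  have hη2 : 0 < η ^ 2 := by positivity
  have hmean : η * 𝔼 j, x j = q + 𝔼 j, (r j + γ * ∑ s, p j s * V j s) := by
    rw [Finset.mul_expect]
    simp only [hx]
    rw [Finset.expect_add_distrib, Fintype.expect_const]
  have hvar : 𝔼 i, ((r i + γ * ∑ s, p i s * V i s) -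
      𝔼 j, (r j + γ * ∑ s, p j s * V j s)) ^ 2 = η ^ 2 * 𝔼 i, (x i - 𝔼 j, x j) ^ 2 := by
    rw [Finset.mul_expect]
    refine Finset.expect_congr rfl fun i _ => ?_
    rw [← mul_pow, mul_sub, hmean, hx]
    ring
  have bound : ∃ (Z : S → ℝ) (t : ι → ℝ), (∀ i s, |V i s - Z s| ≤ t i) ∧
      k * 𝔼 i, (s₁ i + s₂ i * γ * M + t i) ^ 2 ≤ 4 * η ^ 2 * w := by
    rcases henv with h | ⟨c, t, ht, h⟩
    · exact ⟨fun _ => 0, fun _ => M, by simpa using hV, h⟩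
    · refine ⟨fun s => W s + c, t, fun i s => abs_le.2 ⟨?_, ?_⟩, h⟩
      · linarith [(ht i).2, hWV i s]
      · linarith [(ht i).1, hVW i s]
  obtain ⟨Z, t, hZ, h⟩ := bound
  have ht : ∀ i, 0 ≤ t i := fun i => (abs_nonneg _).trans (hZ i (Classical.arbitrary S))
  have := expect_backup_sub_sq_le hγ0 hγ1 hM hr hp0 hp1 hpdiv hV hZ ht
  rw [hvar] at this
  refine le_of_mul_le_mul_left ?_ hη2
  linarith [mul_le_mul_of_nonneg_left this hk]

/-- The spread of the fixed points of regularized Bellman operators with a common regularizer. -/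
lemma mul_expect_fixedPoint_sub_sq_le {ι S A : Type*} [Fintype ι] [Nonempty ι] [Fintype S]
    [Fintype A] [Nonempty S] [Nonempty A] {γ M lam : ℝ} (hγ0 : 0 ≤ γ) (hγ1 : γ ≤ 1) (hM : 0 < M)
    (hlam : 8 < lam ^ 2) {q : S × A → ℝ} {R : ι → S → A → ℝ} {P : ι → S → A → S → ℝ}
    (hP0 : ∀ i s a s', 0 ≤ P i s a s') (hP1 : ∀ i s a, ∑ s', P i s a s' = 1)
    {s₁ s₂ : ι → ℝ} (hs₁ : ∀ i, 0 ≤ s₁ i) (hs₂ : ∀ i, 0 ≤ s₂ i)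
    (hR : ∀ i s a, |R i s a - 𝔼 j, R j s a| ≤ s₁ i)
    (hP : ∀ i s a, ∑ s', |P i s a s' - 𝔼 j, P j s a s'| ≤ s₂ i)
    {Q : ι → S × A → ℝ} (hQM : ∀ i sa, |Q i sa| ≤ M)
    (hQ : ∀ i sa, (1 + lam) * Q i sa =
      q sa + (R i sa.1 sa.2 + γ * ∑ s', P i sa.1 sa.2 s' * maxQ (Q i) s')) (sa : S × A) :
    (lam ^ 2 - 8) * 𝔼 i, (Q i sa - 𝔼 j, Q j sa) ^ 2 ≤
      4 * 𝔼 i, (s₁ i + s₂ i * γ * M) ^ 2 := by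
  set Qb : S × A → ℝ := fun sa => 𝔼 j, Q j sa with hQb
  have hQbM : ∀ sa, |Qb sa| ≤ M := fun sa =>
    (Finset.abs_expect_le _ _).trans (Finset.expect_le Finset.univ_nonempty fun i _ => hQM i sa)
  set V : ι → S → ℝ := fun i => maxQ (Q i) with hVdef
  set W : S → ℝ := maxQ Qb with hWdef
  have hV : ∀ i s, |V i s| ≤ M := fun i => abs_maxQ_le (hQM i)
  have hW : ∀ s, |W s| ≤ M := abs_maxQ_le hQbM
  have hjensen : ∀ s, 0 ≤ 𝔼 j, (V j s - W s) := fun s => by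
    rw [Finset.expect_sub_distrib, Fintype.expect_const]
    exact sub_nonneg.2 (maxQ_expect_le Q s)
  set u : ι → ℝ := fun i => posSup fun sa => Q i sa - Qb sa with hu
  set l : ι → ℝ := fun i => posSup fun sa => Qb sa - Q i sa with hl
  have hu0 : ∀ i, 0 ≤ u i := fun i => posSup_nonneg
  have hl0 : ∀ i, 0 ≤ l i := fun i => posSup_nonneg
  have huM : ∀ i, u i ≤ 2 * M := fun i => posSup_le (by linarith) fun sa => by
    linarith [(abs_le.1 (hQM i sa)).2, (abs_le.1 (hQbM sa)).1]
  have hlM : ∀ i, l i ≤ 2 * M := fun i => posSup_le (by linarith) fun sa => by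
    linarith [(abs_le.1 (hQM i sa)).1, (abs_le.1 (hQbM sa)).2]
  have hVW : ∀ i s, V i s - W s ≤ u i := fun i =>
    maxQ_sub_le_s16 fun sa => le_posSup (f := fun sa => Q i sa - Qb sa) sa
  have hWV : ∀ i s, W s - V i s ≤ l i := fun i =>
    maxQ_sub_le_s16 fun sa => le_posSup (f := fun sa => Qb sa - Q i sa) sa
  have hPh : ∀ i s a, ∑ s', |P i s a s' - 𝔼 j, P j s a s'| ≤ 2 * (s₂ i / 2) := fun i s a =>
    (hP i s a).trans_eq (by ring)
  set T : ι → S × A → ℝ := fun i sa => R i sa.1 sa.2 + γ * ∑ s', P i sa.1 sa.2 s' * V i s' with hT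
  have hdev : ∀ i sa, (1 + lam) * (Q i sa - Qb sa) = T i sa - 𝔼 j, T j sa := by
    intro i sa
    have h1 : (1 + lam) * Qb sa = q sa + 𝔼 j, T j sa := by
      rw [hQb, Finset.mul_expect]
      simp only [hQ]
      rw [Finset.expect_add_distrib, Fintype.expect_const]
    rw [mul_sub, h1, hQ]
    simp only [hT]
    ring
  set mean : S × A → ℝ := fun sa => 𝔼 j, ∑ s', P j sa.1 sa.2 s' * (V j s' - W s') with hmean
  have mean_le : ∀ sa, mean sa ≤ 𝔼 j, u j := fun sa =>
    expect_sum_mul_le (fun j => hP0 j _ _) (fun j => hP1 j _ _) hVW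
  have le_mean : ∀ sa, -𝔼 j, s₂ j / 2 * (u j + l j) ≤ mean sa := fun sa =>
    neg_expect_le_expect_sum_mul (fun j => hP0 j _ _) (fun j => hP1 j _ _) (fun i => hPh i _ _)
      hu0 hl0 hVW (fun j s => by linarith [hWV j s]) hjensen
  have upper : ∀ H, (∀ sa, -H ≤ mean sa) → ∀ i sa, T i sa - 𝔼 j, T j sa ≤
      s₁ i + s₂ i * γ * M + γ * (u i - s₂ i / 2 * u i + H) := by
    intro H hH i sa
    refine (backup_sub_expect_le hγ0 (fun i => hR i sa.1 sa.2) (fun j => hP0 j _ _)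
      (fun j => hP1 j _ _) (fun i => hPh i _ _) hV hW huM hVW (hH sa) i).trans_eq ?_
    ring
  have lower : ∀ U, (∀ sa, mean sa ≤ U) → ∀ i sa, 𝔼 j, T j sa - T i sa ≤
      s₁ i + s₂ i * γ * M + γ * (l i - s₂ i / 2 * l i + U) := by
    intro U hU i sa
    refine (expect_sub_backup_le hγ0 (fun i => hR i sa.1 sa.2) (fun j => hP0 j _ _)
      (fun j => hP1 j _ _) (fun i => hPh i _ _) hV hW hlM hWV (hU sa) i).trans_eq ?_
    ring
  have hσ : ∀ i, 2 * (γ * (s₂ i / 2)) * M ≤ s₁ i + s₂ i * γ * M := fun i => by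
    linarith [hs₁ i]
  have h0 : ∀ i, 0 ≤ γ * (s₂ i / 2) := fun i => mul_nonneg hγ0 (div_nonneg (hs₂ i) zero_le_two)
  have hU0 : 0 ≤ 𝔼 j, u j := Finset.expect_nonneg fun j _ => hu0 j
  have hle : ∀ {a : ℝ}, 0 ≤ a → γ * a ≤ a := fun ha => mul_le_of_le_one_left ha hγ1
  have fits : ∀ i {v : ℝ}, v ≤ 2 * M →
      0 ≤ s₁ i + s₂ i * γ * M - γ * (s₂ i / 2) * v := fun i v hv => by
    linarith [hσ i, mul_le_mul_of_nonneg_left hv (h0 i)]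
  rcases le_total 0 lam with hsign | hsign
  · have hy : 2.82 < lam := by nlinarith
    set d : ι → ℝ := fun i => max (u i) (l i) with hd
    have hd0 : ∀ i, 0 ≤ d i := fun i => (hu0 i).trans (le_max_left _ _)
    have hD0 : 0 ≤ 𝔼 j, d j := Finset.expect_nonneg fun j _ => hd0 j
    have hUd : 𝔼 j, u j ≤ 𝔼 j, d j := Finset.expect_le_expect fun j _ => le_max_left _ _
    have hmean : ∀ sa, -𝔼 j, d j ≤ mean sa := fun sa => by
      have h1 : -mean sa ≤ 𝔼 j, l j := by
        have h2 := expect_sum_mul_le (X := fun j s' => W s' - V j s')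
          (fun j => hP0 j sa.1 sa.2) (fun j => hP1 j sa.1 sa.2) hWV
        refine le_trans (le_of_eq ?_) h2
        rw [hmean, ← Finset.expect_neg_distrib]
        refine Finset.expect_congr rfl fun j _ => ?_
        rw [← Finset.sum_neg_distrib]
        exact Finset.sum_congr rfl fun s' _ => by ring
      have h3 : 𝔼 j, l j ≤ 𝔼 j, d j := Finset.expect_le_expect fun j _ => le_max_right _ _
      linarith
    have hdrop : ∀ i {v : ℝ}, 0 ≤ v → v ≤ d i →
        γ * (v - s₂ i / 2 * v + 𝔼 j, d j) ≤ d i + 𝔼 j, d j := fun i v hv hvd => by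
      have h1 := mul_nonneg (h0 i) hv
      linarith [hle hv, hle hD0]
    have hσ0 : ∀ i, 0 ≤ s₁ i + s₂ i * γ * M := fun i => by simpa using fits i (v := 0) (by linarith)
    have env := envelopeBound_of_pos (y := 1 + lam) (M := M)
      (σ := fun i => s₁ i + s₂ i * γ * M) (d := d) (by linarith) (by linarith) hd0 (fun i => by
        rw [hd, mul_max_of_nonneg _ _ (by linarith)]
        refine max_le ?_ ?_
        · refine mul_posSup_le (by linarith) (by linarith [hσ0 i, hd0 i]) fun sa => ?_
          rw [hdev]
          linarith [upper _ hmean i sa, hdrop i (hu0 i) (le_max_left _ _)]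
        · refine mul_posSup_le (by linarith) (by linarith [hσ0 i, hd0 i]) fun sa => ?_
          linarith [hdev i sa, lower _ (fun sa => (mean_le sa).trans hUd) i sa,
            hdrop i (hl0 i) (le_max_right _ _)])
    rw [show (1 + lam) ^ 2 - 2 * (1 + lam) - 7 = lam ^ 2 - 8 by ring] at env
    exact expect_sub_expect_sq_le_of_envelope hγ0 hγ1 hM.le (by linarith) (by linarith)
      (fun i => hR i sa.1 sa.2) (fun j => hP0 j _ _) (fun j => hP1 j _ _)
      (fun i => hP i sa.1 sa.2) hV (fun i s => (hVW i s).trans (le_max_left _ _))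
      (fun i s => (hWV i s).trans (le_max_right _ _)) (fun i => hQ i sa) env
  · have hy : lam < -2.82 := by nlinarith
    have hH0 : 0 ≤ 𝔼 j, γ * (s₂ j / 2) * (u j + l j) := Finset.expect_nonneg fun j _ =>
      mul_nonneg (h0 j) (add_nonneg (hu0 j) (hl0 j))
    have hH : 𝔼 j, γ * (s₂ j / 2) * (u j + l j) = γ * 𝔼 j, s₂ j / 2 * (u j + l j) := by
      simp only [Finset.mul_expect, mul_assoc]
    have env := envelopeBound_of_neg (x := -(1 + lam)) (M := M) (u := u) (l := l)
      (σ := fun i => s₁ i + s₂ i * γ * M) (h := fun i => γ * (s₂ i / 2))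
      (by linarith) (by linarith) hM hu0 hl0 h0 hσ (fun i => by
        refine mul_posSup_le (by linarith) (by linarith [fits i (hlM i), hl0 i]) fun sa => ?_
        linarith [hdev i sa, lower _ mean_le i sa, hle (hl0 i), hle hU0]) (fun i => by
        refine mul_posSup_le (by linarith) (by linarith [fits i (huM i), hu0 i]) fun sa => ?_
        linarith [hdev i sa, upper _ le_mean i sa, hle (hu0 i)])
    rw [show (-(1 + lam)) ^ 2 + 2 * -(1 + lam) - 7 = lam ^ 2 - 8 by ring] at env
    exact expect_sub_expect_sq_le_of_envelope hγ0 hγ1 hM.le (by linarith) (by linarith)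
      (fun i => hR i sa.1 sa.2) (fun j => hP0 j _ _) (fun j => hP1 j _ _)
      (fun i => hP i sa.1 sa.2) hV hVW hWV (fun i => hQ i sa)
      (by simpa only [EnvelopeBound, neg_sq] using env)

lemma expect_sub_sq_le {ι : Type*} [Fintype ι] [Nonempty ι] {x y : ι → ℝ} {a δ : ℝ}
    (hxy : ∀ i, |x i - y i| ≤ δ) :
    𝔼 i, (x i - a) ^ 2 ≤
      2 * δ ^ 2 + 2 * (a - 𝔼 j, y j) ^ 2 + 2 * 𝔼 i, (y i - 𝔼 j, y j) ^ 2 := by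
  set m := 𝔼 j, y j with hm
  have point : ∀ i, (x i - a) ^ 2 ≤
      2 * δ ^ 2 + 2 * (a - m) ^ 2 + 2 * (y i - m) ^ 2 + 4 * (m - a) * (y i - m) := fun i => by
    nlinarith [sq_le_sq' (abs_le.1 (hxy i)).1 (abs_le.1 (hxy i)).2,
      sq_nonneg ((x i - y i) - (y i - a))]
  have total := Finset.expect_le_expect (s := Finset.univ) fun i _ => point i
  simp only [Finset.expect_add_distrib, ← Finset.mul_expect, Finset.expect_sub_distrib,
    Fintype.expect_const, ← hm] at total
  linarith

/-- per-round deterministic form of Theorem 2(b): with task fixed points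
`Q_i*`, gradients `g_i = λ(Qπ − Q_i*)`, `ḡ = (1/N)Σ_i g_i`, and personalized tables
`Q_i^{π_i}` with `‖Q_i^{π_i} − Q_i*‖∞ ≤ δ`, for every `(s,a)`:
`(1/N)·Σ_i (Q_i^{π_i}(s,a) − Qπ(s,a))² ≤ 2δ² + (2/(λ²−8))·ḡ(s,a)² + 4σ₂²/λ²`, where
`σ₂² = (2λ²/(λ²−8))·σ² + (2λ²γ/((λ²−8)(1−γ)))·Rmax` and
`σ² = (1/N)·Σ_i (σ_{1,i} + σ_{2,i}·γ·Rmax/(1−γ))²`. -/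
theorem personalized_meta_gap_bound {S A : Type*} [Fintype S] [Fintype A]
    [Nonempty S] [Nonempty A]
    (N : ℕ) (hN : 1 ≤ N) (γ Rmax lam δ : ℝ)
    (hγ0 : 0 ≤ γ) (hγ1 : γ < 1) (hRmax : 0 < Rmax) (hlam : 8 < lam^2) (hδ : 0 ≤ δ)
    (Qpi : S × A → ℝ) (hQpi : ‖Qpi‖ ≤ Rmax / (1 - γ))
    (Rew : Fin N → S → A → ℝ) (P : Fin N → S → A → S → ℝ)
    (hRb : ∀ i s a, |Rew i s a| ≤ Rmax)
    (hP0 : ∀ i s a s', 0 ≤ P i s a s') (hP1 : ∀ i s a, ∑ s', P i s a s' = 1)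
    (σ1 σ2 : Fin N → ℝ) (hσ1 : ∀ i, 0 ≤ σ1 i) (hσ2 : ∀ i, 0 ≤ σ2 i)
    (hRdiv : ∀ i s a, |Rew i s a - (1 / (N : ℝ)) * ∑ j, Rew j s a| ≤ σ1 i)
    (hPdiv : ∀ i s a, ∑ s', |P i s a s' - (1 / (N : ℝ)) * ∑ j, P j s a s'| ≤ σ2 i)
    (Qstar : Fin N → S × A → ℝ)
    (hfix : ∀ i, Bhat (P i) (Rew i) γ lam Qpi (Qstar i) = Qstar i)
    (hQstar : ∀ i, ‖Qstar i‖ ≤ Rmax / (1 - γ))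
    (g : Fin N → S × A → ℝ) (hg : ∀ i sa, g i sa = lam * (Qpi sa - Qstar i sa))
    (gbar : S × A → ℝ) (hgbar : ∀ sa, gbar sa = (1 / (N : ℝ)) * ∑ i, g i sa)
    (Qp : Fin N → S × A → ℝ) (hQp : ∀ i, ‖Qp i - Qstar i‖ ≤ δ) :
    ∀ sa : S × A,
      (1 / (N : ℝ)) * ∑ i, (Qp i sa - Qpi sa)^2 ≤
        2 * δ^2 + (2 / (lam^2 - 8)) * (gbar sa)^2 +
        4 * ((2 * lam^2 / (lam^2 - 8)) *
              ((1 / (N : ℝ)) * ∑ i, (σ1 i + σ2 i * γ * Rmax / (1 - γ))^2) +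
            (2 * lam^2 * γ / ((lam^2 - 8) * (1 - γ))) * Rmax) / lam^2 := by
  intro sa
  have : Nonempty (Fin N) := ⟨⟨0, hN⟩⟩
  have mean : ∀ f : Fin N → ℝ, 1 / (N : ℝ) * ∑ i, f i = 𝔼 i, f i := fun f => by
    rw [Fintype.expect_eq_sum_div_card, Fintype.card_fin, one_div_mul_eq_div]
  have hγ : 0 < 1 - γ := by linarith
  have hlam0 : lam ≠ 0 := by
    rintro rfl
    norm_num at hlam
  have hη : 1 + lam ≠ 0 := by
    intro h
    obtain rfl : lam = -1 := by linarith
    norm_num at hlam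
  have hk : 0 < lam ^ 2 - 8 := by linarith
  simp only [mean] at hRdiv hPdiv hgbar ⊢
  have spread := mul_expect_fixedPoint_sub_sq_le hγ0 hγ1.le (div_pos hRmax hγ) hlam
    (q := fun sa => lam * Qpi sa) hP0 hP1 hσ1 hσ2 hRdiv hPdiv
    (fun i sa => (norm_le_pi_norm (Qstar i) sa).trans (hQstar i)) (fun i sa => by
      have h := congrFun (hfix i) sa
      rw [Bhat] at h
      rw [← h]
      field_simp) sa
  have hσ : ∀ i, σ1 i + σ2 i * γ * Rmax / (1 - γ) = σ1 i + σ2 i * γ * (Rmax / (1 - γ)) :=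
    fun i => by rw [mul_div_assoc]
  simp only [← hσ] at spread
  have split := expect_sub_sq_le (a := Qpi sa)
    fun i => (norm_le_pi_norm (Qp i - Qstar i) sa).trans (hQp i)
  have hgb : gbar sa = lam * (Qpi sa - 𝔼 j, Qstar j sa) := by
    simp only [hgbar, hg]
    rw [← Finset.mul_expect, Finset.expect_sub_distrib, Fintype.expect_const]
  have grad : 2 * (Qpi sa - 𝔼 j, Qstar j sa) ^ 2 ≤ 2 / (lam ^ 2 - 8) * gbar sa ^ 2 := by
    rw [hgb, div_mul_eq_mul_div, le_div_iff₀ hk]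
    nlinarith [sq_nonneg (Qpi sa - 𝔼 j, Qstar j sa)]
  set w := 𝔼 i, (σ1 i + σ2 i * γ * Rmax / (1 - γ)) ^ 2
  have diversity : 2 * 𝔼 i, (Qstar i sa - 𝔼 j, Qstar j sa) ^ 2 ≤
      4 * (2 * lam ^ 2 / (lam ^ 2 - 8) * w +
        2 * lam ^ 2 * γ / ((lam ^ 2 - 8) * (1 - γ)) * Rmax) / lam ^ 2 := by
    have e : 4 * (2 * lam ^ 2 / (lam ^ 2 - 8) * w +
        2 * lam ^ 2 * γ / ((lam ^ 2 - 8) * (1 - γ)) * Rmax) / lam ^ 2 =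
        8 * w / (lam ^ 2 - 8) + 8 * γ * Rmax / ((lam ^ 2 - 8) * (1 - γ)) := by
      field_simp
      ring
    rw [e]
    refine le_add_of_le_of_nonneg ?_ (by positivity)
    rw [le_div_iff₀ hk]
    linarith
  linarith
end
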